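/- arXiv:2602.11835 — 3 statements merged into one kernel-verified Lean document; each statement's English description precedes it below -/
import Mathlib

section
/- For all real numbers x₁ and x₂, ((x₁−1)(x₂+1)² + (x₁+1)(x₂−1)²)² ≥ (x₁−1)²(x₂+1)² + (x₁+1)²(x₂−1)² − 2(x₂²−1)²/(x₂²+1). Equivalently, writing f^{(1)}(x₁,x₂) = (x₁−1)²(x₂+1)² + (x₁+1)²(x₂−1)², the first-coordinate partial derivative satisfies (∂f^{(1)}/∂x₁(x₁,x₂))² ≥ 4·(f^{(1)}(x₁,x₂) − inf_{y₁∈ℝ} f^{(1)}(y₁,x₂)); since f^{(1)} is symmetric in its two arguments, f^{(1)} satisfies the 2-sided PL condition with constant μ = 2. -/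
/-- The gap between `(x−1)²(t+1)² + (x+1)²(t−1)²` and its infimum over `x` is the square of
half the derivative in `x`, divided by `2(t²+1)`. -/
lemma gap_eq_sq_div (x t : ℝ) :
    (x - 1) ^ 2 * (t + 1) ^ 2 + (x + 1) ^ 2 * (t - 1) ^ 2 - 2 * (t ^ 2 - 1) ^ 2 / (t ^ 2 + 1)
      = ((x - 1) * (t + 1) ^ 2 + (x + 1) * (t - 1) ^ 2) ^ 2 / (2 * (t ^ 2 + 1)) := by
  have ht : t ^ 2 + 1 ≠ 0 := by positivity
  field_simp
  ring

lemma gap_le_sq (x t : ℝ) :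
    (x - 1) ^ 2 * (t + 1) ^ 2 + (x + 1) ^ 2 * (t - 1) ^ 2 - 2 * (t ^ 2 - 1) ^ 2 / (t ^ 2 + 1)
      ≤ ((x - 1) * (t + 1) ^ 2 + (x + 1) * (t - 1) ^ 2) ^ 2 := by
  rw [gap_eq_sq_div]
  exact div_le_self (sq_nonneg _) (by nlinarith [sq_nonneg t])

lemma hasDerivAt_fst (x t : ℝ) :
    HasDerivAt (fun y : ℝ => (y - 1) ^ 2 * (t + 1) ^ 2 + (y + 1) ^ 2 * (t - 1) ^ 2)
      (2 * ((x - 1) * (t + 1) ^ 2 + (x + 1) * (t - 1) ^ 2)) x := by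
  have h₁ := (((hasDerivAt_id' x).sub_const 1).fun_pow 2).mul_const ((t + 1) ^ 2)
  have h₂ := (((hasDerivAt_id' x).add_const 1).fun_pow 2).mul_const ((t - 1) ^ 2)
  refine (h₁.fun_add h₂).congr_deriv ?_
  norm_num
  ring

lemma four_mul_gap_le_sq_deriv (x t : ℝ) :
    2 * 2 * ((x - 1) ^ 2 * (t + 1) ^ 2 + (x + 1) ^ 2 * (t - 1) ^ 2
        - 2 * (t ^ 2 - 1) ^ 2 / (t ^ 2 + 1))
      ≤ (deriv (fun y : ℝ => (y - 1) ^ 2 * (t + 1) ^ 2 + (y + 1) ^ 2 * (t - 1) ^ 2) x) ^ 2 := by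
  rw [(hasDerivAt_fst x t).deriv, mul_pow]
  linarith [gap_le_sq x t]

/-- The key inequality showing `f⁽¹⁾(x₁,x₂) = (x₁−1)²(x₂+1)² + (x₁+1)²(x₂−1)²` satisfies the
2-sided PL condition with constant `μ = 2`: the plain algebraic inequality, its partial
derivative form in the first coordinate, and (by symmetry) the form in the second coordinate,
where the coordinatewise infima are `2(x₂²−1)²/(x₂²+1)` resp. `2(x₁²−1)²/(x₁²+1)`. -/
theorem f1_two_sided_PL
    (f : ℝ → ℝ → ℝ)
    (hf : f = fun x₁ x₂ => (x₁ - 1) ^ 2 * (x₂ + 1) ^ 2 + (x₁ + 1) ^ 2 * (x₂ - 1) ^ 2) :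
    (∀ x₁ x₂ : ℝ,
      ((x₁ - 1) * (x₂ + 1) ^ 2 + (x₁ + 1) * (x₂ - 1) ^ 2) ^ 2
        ≥ (x₁ - 1) ^ 2 * (x₂ + 1) ^ 2 + (x₁ + 1) ^ 2 * (x₂ - 1) ^ 2
            - 2 * (x₂ ^ 2 - 1) ^ 2 / (x₂ ^ 2 + 1)) ∧
    (∀ x₁ x₂ : ℝ,
      (deriv (fun y => f y x₂) x₁) ^ 2
        ≥ 2 * 2 * (f x₁ x₂ - 2 * (x₂ ^ 2 - 1) ^ 2 / (x₂ ^ 2 + 1))) ∧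
    (∀ x₁ x₂ : ℝ,
      (deriv (fun y => f x₁ y) x₂) ^ 2
        ≥ 2 * 2 * (f x₁ x₂ - 2 * (x₁ ^ 2 - 1) ^ 2 / (x₁ ^ 2 + 1))) := by
  subst hf
  refine ⟨gap_le_sq, four_mul_gap_le_sq_deriv, fun x₁ x₂ => ?_⟩
  have hsymm (a b : ℝ) : (a - 1) ^ 2 * (b + 1) ^ 2 + (a + 1) ^ 2 * (b - 1) ^ 2
      = (b - 1) ^ 2 * (a + 1) ^ 2 + (b + 1) ^ 2 * (a - 1) ^ 2 := by ring
  simpa only [hsymm x₁] using four_mul_gap_le_sq_deriv x₂ x₁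
end

section
/- Let f^{(1)}(x₁,x₂) = (x₁−1)²(x₂+1)² + (x₁+1)²(x₂−1)². Then (0,0) is a Nash equilibrium of the two-player potential game in which both players' objective is f^{(1)}, i.e., f^{(1)}(x₁, 0) ≥ f^{(1)}(0,0) for all x₁ ∈ ℝ and f^{(1)}(0, x₂) ≥ f^{(1)}(0,0) for all x₂ ∈ ℝ; however, (0,0) is not a local minimum of f^{(1)}: every neighborhood of (0,0) in ℝ² contains a point (x₁,x₂) with f^{(1)}(x₁,x₂) < f^{(1)}(0,0). -/
/-- `(0,0)` is a Nash equilibrium of the two-player potential game with common objective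
`f⁽¹⁾(x₁,x₂) = (x₁−1)²(x₂+1)² + (x₁+1)²(x₂−1)²`, but it is not a local minimum of `f⁽¹⁾`:
every neighborhood of `(0,0)` contains a point with strictly smaller value. -/
theorem f1_origin_nash_not_local_min
    (f : ℝ → ℝ → ℝ)
    (hf : f = fun x₁ x₂ => (x₁ - 1) ^ 2 * (x₂ + 1) ^ 2 + (x₁ + 1) ^ 2 * (x₂ - 1) ^ 2) :
    (∀ x₁ : ℝ, f 0 0 ≤ f x₁ 0) ∧
    (∀ x₂ : ℝ, f 0 0 ≤ f 0 x₂) ∧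
    (∀ U ∈ nhds ((0, 0) : ℝ × ℝ), ∃ p ∈ U, f p.1 p.2 < f 0 0) := by
  subst hf
  refine ⟨fun x => by nlinarith [sq_nonneg x], fun x => by nlinarith [sq_nonneg x],
    fun U hU => ?_⟩
  obtain ⟨ε, hε, hball⟩ := Metric.mem_nhds_iff.mp hU
  obtain ⟨t, ht, ht'⟩ := exists_between (lt_min hε one_pos)
  obtain ⟨htε, ht1⟩ := lt_min_iff.mp ht'
  refine ⟨(t, t), hball ?_, ?_⟩
  · simpa [Prod.dist_eq, abs_of_pos ht] using htε
  · have hsq : 0 < t ^ 2 := by positivity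
    have hsq1 : t ^ 2 < 1 := by nlinarith
    dsimp only
    nlinarith [mul_pos hsq (sub_pos.mpr hsq1)]
end

section
/- Let f^{(2)}(x₁,x₂) = (x₁−1)²(x₂+1)² + (x₁+1)²(x₂−1)² + exp(−(x₂−1)²). Then for all (x₁,x₂) ∈ ℝ², the second partial derivatives satisfy ∂²f^{(2)}/∂x₁² ≥ 4 and ∂²f^{(2)}/∂x₂² ≥ 2, and consequently (∂f^{(2)}/∂x₁(x₁,x₂))² ≥ 8·(f^{(2)}(x₁,x₂) − inf_{y₁∈ℝ} f^{(2)}(y₁,x₂)) and (∂f^{(2)}/∂x₂(x₁,x₂))² ≥ 4·(f^{(2)}(x₁,x₂) − inf_{y₂∈ℝ} f^{(2)}(x₁,y₂)); in particular f^{(2)} satisfies the 2-sided PL condition with constant μ = 2. -/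
/-- A function whose second derivative is bounded below by `m > 0` satisfies the
Polyak–Łojasiewicz inequality with constant `m`. -/
theorem two_mul_sub_iInf_le_sq_of_le_deriv2 {g g' g'' : ℝ → ℝ} {m : ℝ} (hm : 0 < m)
    (hg : ∀ x, HasDerivAt g (g' x) x) (hg' : ∀ x, HasDerivAt g' (g'' x) x)
    (hg'' : ∀ x, m ≤ g'' x) (x : ℝ) :
    2 * m * (g x - ⨅ y, g y) ≤ g' x ^ 2 := by
  have h₁ (y : ℝ) : HasDerivAt (fun z => g z - m / 2 * z ^ 2) (g' y - m * y) y :=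
    ((hg y).sub (((hasDerivAt_id' y).pow 2).const_mul (m / 2))).congr_deriv (by norm_num; ring)
  have h₂ (y : ℝ) : HasDerivAt (fun z => g' z - m * z) (g'' y - m) y :=
    ((hg' y).sub ((hasDerivAt_id' y).const_mul m)).congr_deriv (by ring)
  have hconv : ConvexOn ℝ Set.univ (fun z => g z - m / 2 * z ^ 2) :=
    convexOn_of_hasDerivWithinAt2_nonneg convex_univ
      (fun y _ => (h₁ y).continuousAt.continuousWithinAt) (fun y _ => (h₁ y).hasDerivWithinAt)
      (fun y _ => (h₂ y).hasDerivWithinAt) (fun y _ => sub_nonneg.2 (hg'' y))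
  have hquad (y : ℝ) : g x + g' x * (y - x) + m / 2 * (y - x) ^ 2 ≤ g y := by
    rcases lt_trichotomy x y with h | rfl | h
    · have := hconv.le_slope_of_hasDerivAt (Set.mem_univ x) (Set.mem_univ y) h (h₁ x)
      rw [slope_def_field, le_div_iff₀ (sub_pos.2 h)] at this
      linarith
    · simp
    · have := hconv.slope_le_of_hasDerivAt (Set.mem_univ y) (Set.mem_univ x) h (h₁ x)
      rw [slope_def_field, div_le_iff₀ (sub_pos.2 h)] at this
      linarith
  have hinf : g x - g' x ^ 2 / (2 * m) ≤ ⨅ y, g y := by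
    refine le_ciInf fun y => le_trans ?_ (hquad y)
    have h : g' x * (y - x) + m / 2 * (y - x) ^ 2 + g' x ^ 2 / (2 * m)
        = (m * (y - x) + g' x) ^ 2 / (2 * m) := by
      field_simp
      ring
    have : 0 ≤ (m * (y - x) + g' x) ^ 2 / (2 * m) := by positivity
    linarith
  rw [mul_comm, ← le_div_iff₀ (by positivity)]
  linarith

/-- `f⁽²⁾(x₁,x₂) = (x₁−1)²(x₂+1)² + (x₁+1)²(x₂−1)² + exp(−(x₂−1)²)` has coordinatewise second
derivatives bounded below by `4` and `2` respectively; consequently its squared partial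
derivatives dominate `8` resp. `4` times the gap to the coordinatewise infimum — in particular
`f⁽²⁾` satisfies the 2-sided PL condition with constant `μ = 2`. -/
theorem f2_two_sided_PL
    (f : ℝ → ℝ → ℝ)
    (hf : f = fun x₁ x₂ => (x₁ - 1) ^ 2 * (x₂ + 1) ^ 2 + (x₁ + 1) ^ 2 * (x₂ - 1) ^ 2
      + Real.exp (-(x₂ - 1) ^ 2)) :
    (∀ x₁ x₂ : ℝ, 4 ≤ deriv (fun y => deriv (fun z => f z x₂) y) x₁) ∧
    (∀ x₁ x₂ : ℝ, 2 ≤ deriv (fun y => deriv (fun z => f x₁ z) y) x₂) ∧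
    (∀ x₁ x₂ : ℝ,
      (deriv (fun y => f y x₂) x₁) ^ 2 ≥ 8 * (f x₁ x₂ - ⨅ y₁ : ℝ, f y₁ x₂)) ∧
    (∀ x₁ x₂ : ℝ,
      (deriv (fun y => f x₁ y) x₂) ^ 2 ≥ 4 * (f x₁ x₂ - ⨅ y₂ : ℝ, f x₁ y₂)) := by
  subst hf
  have hx (b a : ℝ) : HasDerivAt (fun z : ℝ => (z - 1) ^ 2 * (b + 1) ^ 2 + (z + 1) ^ 2 * (b - 1) ^ 2
      + Real.exp (-(b - 1) ^ 2)) (2 * (a - 1) * (b + 1) ^ 2 + 2 * (a + 1) * (b - 1) ^ 2) a :=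
    ((((((hasDerivAt_id' a).sub_const 1).pow 2).mul_const _).add
      ((((hasDerivAt_id' a).add_const 1).pow 2).mul_const _)).add_const _).congr_deriv
      (by norm_num)
  have hxx (b a : ℝ) : HasDerivAt
      (fun z : ℝ => 2 * (z - 1) * (b + 1) ^ 2 + 2 * (z + 1) * (b - 1) ^ 2) (4 + 4 * b ^ 2) a :=
    (((((hasDerivAt_id' a).sub_const 1).const_mul 2).mul_const _).add
      ((((hasDerivAt_id' a).add_const 1).const_mul 2).mul_const _)).congr_deriv (by ring)
  have hexp (b : ℝ) : HasDerivAt (fun z : ℝ => Real.exp (-(z - 1) ^ 2))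
      (-2 * (b - 1) * Real.exp (-(b - 1) ^ 2)) b :=
    (((hasDerivAt_id' b).sub_const 1).pow 2).neg.exp.congr_deriv (by norm_num; ring)
  have hy (a b : ℝ) : HasDerivAt (fun z : ℝ => (a - 1) ^ 2 * (z + 1) ^ 2 + (a + 1) ^ 2 * (z - 1) ^ 2
      + Real.exp (-(z - 1) ^ 2)) (2 * (b + 1) * (a - 1) ^ 2 + 2 * (b - 1) * (a + 1) ^ 2
      + -2 * (b - 1) * Real.exp (-(b - 1) ^ 2)) b :=
    ((((((hasDerivAt_id' b).add_const 1).pow 2).const_mul _).add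
      ((((hasDerivAt_id' b).sub_const 1).pow 2).const_mul _)).add (hexp b)).congr_deriv
      (by norm_num; ring)
  have hyy (a b : ℝ) : HasDerivAt (fun z : ℝ => 2 * (z + 1) * (a - 1) ^ 2
      + 2 * (z - 1) * (a + 1) ^ 2 + -2 * (z - 1) * Real.exp (-(z - 1) ^ 2))
      (4 + 4 * a ^ 2 + (4 * (b - 1) ^ 2 - 2) * Real.exp (-(b - 1) ^ 2)) b :=
    ((((((hasDerivAt_id' b).add_const 1).const_mul 2).mul_const _).add
      ((((hasDerivAt_id' b).sub_const 1).const_mul 2).mul_const _)).add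
      ((((hasDerivAt_id' b).sub_const 1).const_mul (-2)).mul (hexp b))).congr_deriv (by ring)
  have hxx_le (b : ℝ) : 4 ≤ 4 + 4 * b ^ 2 := by nlinarith [sq_nonneg b]
  have hyy_le (a b : ℝ) :
      2 ≤ 4 + 4 * a ^ 2 + (4 * (b - 1) ^ 2 - 2) * Real.exp (-(b - 1) ^ 2) := by
    have hle : Real.exp (-(b - 1) ^ 2) ≤ 1 :=
      Real.exp_le_one_iff.2 (by nlinarith [sq_nonneg (b - 1)])
    have hnn : 0 ≤ (b - 1) ^ 2 * Real.exp (-(b - 1) ^ 2) := by positivity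
    nlinarith [sq_nonneg a]
  refine ⟨fun a b => ?_, fun a b => ?_, fun a b => ?_, fun a b => ?_⟩
  · simp only [(hx b _).deriv, (hxx b _).deriv]
    exact hxx_le b
  · simp only [(hy a _).deriv, (hyy a _).deriv]
    exact hyy_le a b
  · have := two_mul_sub_iInf_le_sq_of_le_deriv2 four_pos (hx b) (hxx b) (fun _ => hxx_le b) a
    rw [(hx b a).deriv]
    norm_num at this ⊢
    exact this
  · have := two_mul_sub_iInf_le_sq_of_le_deriv2 two_pos (hy a) (hyy a) (hyy_le a) b
    rw [(hy a b).deriv]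
    norm_num at this ⊢
    exact this
end
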